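/- arXiv:2605.22852 — 6 statements merged into one kernel-verified Lean document; each statement's English description precedes it below -/
import Mathlib

section
/- Let L be a finite relational language and let (F,v) be a pointed finite L-structure with n elements. Then there exist finitely many pointed finite L-structures (H1,w1),…,(Hk,wk), each having at most n elements, and rational numbers α1,…,αk, such that for every pointed finite L-structure (D,u), the number of embeddings from (F,v) to (D,u) equals the sum over i of αi times the number of homomorphisms from (Hi,wi) to (D,u). -/
/-- A relational language: a type of relation symbols, each with an arity. -/
structure RelLang : Type 1 where
  Rel : Type
  ar : Rel → ℕ

/-- An `L`-structure on universe `α`: an interpretation of each relation symbol. -/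
structure Str (L : RelLang) (α : Type) : Type where
  rel : ∀ r : L.Rel, (Fin (L.ar r) → α) → Prop

/-- `f` is a homomorphism from `A` to `B`. -/
def IsHom {L : RelLang} {α β : Type} (A : Str L α) (B : Str L β) (f : α → β) : Prop :=
  ∀ (r : L.Rel) (x : Fin (L.ar r) → α), A.rel r x → B.rel r (f ∘ x)

/-- `f` is an embedding from `A` to `B`: an injective homomorphism that also reflects
all relations. -/
def IsEmb {L : RelLang} {α β : Type} (A : Str L α) (B : Str L β) (f : α → β) : Prop :=
  Function.Injective f ∧ ∀ (r : L.Rel) (x : Fin (L.ar r) → α), A.rel r x ↔ B.rel r (f ∘ x)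

/-- Rational-valued parameters of pointed finite `L`-structures. -/
abbrev PointedParam (L : RelLang) : Type 1 :=
  ∀ δ : {δ : Type // Finite δ}, Str L δ.1 → δ.1 → ℚ

/-- The number of pointed maps from `(α, v)` satisfying a property relative to the target. -/
noncomputable def countMaps {L : RelLang} {α : Type} (v : α)
    (P : ∀ {δ : Type}, Str L δ → (α → δ) → Prop) : PointedParam L :=
  fun δ D u => (Nat.card {h : α → δ.1 // P D h ∧ h v = u} : ℚ)

/-- The number of pointed homomorphisms from `(A, v)`. -/
noncomputable def homCount {L : RelLang} {α : Type} (A : Str L α) (v : α) : PointedParam L :=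
  countMaps v fun D h => IsHom A D h

/-- The rational span of the homomorphism counts from structures with at most `n` elements. -/
def homSpan (L : RelLang) (n : ℕ) : Submodule ℚ (PointedParam L) :=
  Submodule.span ℚ {φ | ∃ (γ : Type) (_ : Finite γ) (A : Str L γ) (w : γ),
    Nat.card γ ≤ n ∧ φ = homCount A w}

/-- The quotient of a structure by an equivalence relation. -/
def Str.quotient {L : RelLang} {α : Type} (A : Str L α) (s : Setoid α) : Str L (Quotient s) where
  rel r y := ∃ x, A.rel r x ∧ Quotient.mk s ∘ x = y

/-- The structure obtained by forcing the relation `t.1` to hold at the tuple `t.2`. -/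
def Str.addTuple {L : RelLang} {α : Type} (A : Str L α)
    (t : Σ r : L.Rel, Fin (L.ar r) → α) : Str L α where
  rel r x := A.rel r x ∨ ⟨r, x⟩ = t

theorem isHom_quotient_iff {L : RelLang} {α δ : Type} (A : Str L α) (s : Setoid α)
    (D : Str L δ) (g : Quotient s → δ) :
    IsHom (A.quotient s) D g ↔ IsHom A D (g ∘ Quotient.mk s) := by
  constructor
  · intro hg r x hx
    exact hg r _ ⟨x, hx, rfl⟩
  · rintro hg r _ ⟨x, hx, rfl⟩
    exact hg r x hx

theorem isHom_addTuple_iff {L : RelLang} {α δ : Type} (A : Str L α)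
    (t : Σ r : L.Rel, Fin (L.ar r) → α) (D : Str L δ) (h : α → δ) :
    IsHom (A.addTuple t) D h ↔ IsHom A D h ∧ D.rel t.1 (h ∘ t.2) := by
  constructor
  · intro hh
    exact ⟨fun r x hx => hh r x (Or.inl hx), hh t.1 t.2 (Or.inr rfl)⟩
  · rintro ⟨hh, ht⟩ r x (hx | rfl)
    · exact hh r x hx
    · exact ht

theorem countMaps_congr {L : RelLang} {α : Type} (v : α)
    {P Q : ∀ {δ : Type}, Str L δ → (α → δ) → Prop}
    (hPQ : ∀ {δ : Type} (D : Str L δ) (h : α → δ), P D h ↔ Q D h) :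
    countMaps v P = countMaps v Q := by
  funext δ D u
  simp only [countMaps, hPQ]

theorem countMaps_eq_sum_fiber {L : RelLang} {α ι : Type} [Finite α] [Fintype ι] (v : α)
    (P : ∀ {δ : Type}, Str L δ → (α → δ) → Prop)
    (k : ∀ {δ : Type}, Str L δ → (α → δ) → ι) :
    countMaps v P = ∑ i, countMaps v fun D h => P D h ∧ k D h = i := by
  funext δ D u
  have := δ.2
  simp only [Finset.sum_apply, countMaps]
  rw [← Nat.cast_sum, ← Nat.card_sigma]
  congr 1
  refine Nat.card_congr
    { toFun := fun h => ⟨k D h.1, h.1, ⟨h.2.1, rfl⟩, h.2.2⟩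
      invFun := fun h => ⟨h.2.1, h.2.2.1.1, h.2.2.2⟩
      left_inv := fun _ => rfl
      right_inv := ?_ }
  rintro ⟨_, h, ⟨_, rfl⟩, _⟩
  rfl

theorem countMaps_injective_quotient {L : RelLang} {α : Type} (A : Str L α) (v : α)
    (s : Setoid α) :
    countMaps (Quotient.mk s v) (fun D g => IsHom (A.quotient s) D g ∧ Function.Injective g) =
      countMaps v fun D h => IsHom A D h ∧ Setoid.ker h = s := by
  funext δ D u
  simp only [countMaps]
  congr 1
  refine Nat.card_congr
    { toFun := fun g => ⟨g.1 ∘ Quotient.mk s,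
        ⟨(isHom_quotient_iff A s D g.1).1 g.2.1.1, ?_⟩, g.2.2⟩
      invFun := fun h => ⟨Quotient.lift h.1 fun a b hab =>
          (Setoid.ext_iff.1 h.2.1.2 a b).2 hab,
        ⟨(isHom_quotient_iff A s D _).2 h.2.1.1, ?_⟩, h.2.2⟩
      left_inv := ?_
      right_inv := fun _ => rfl }
  · ext a b
    exact g.2.1.2.eq_iff.trans Quotient.eq
  · rintro ⟨a⟩ ⟨b⟩ hab
    exact Quotient.sound ((Setoid.ext_iff.1 h.2.1.2 a b).1 hab)
  · rintro ⟨g, hg⟩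
    apply Subtype.ext
    funext a
    induction a using Quotient.inductionOn
    rfl

theorem card_quotient_lt {α : Type} [Finite α] {s : Setoid α} (hs : s ≠ ⊥) :
    Nat.card (Quotient s) < Nat.card α := by
  refine lt_of_le_of_ne (Nat.card_le_card_of_surjective _ Quotient.mk_surjective) fun heq => hs ?_
  have hbij := (Nat.bijective_iff_surjective_and_card (Quotient.mk s)).2
    ⟨Quotient.mk_surjective, heq.symm⟩
  rw [eq_bot_iff]
  intro a b hab
  exact hbij.1 (Quotient.sound hab)

theorem countMaps_injective_mem_homSpan {L : RelLang} {n : ℕ} {α : Type} [Finite α]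
    (A : Str L α) (v : α) (hn : Nat.card α ≤ n) :
    countMaps v (fun D h => IsHom A D h ∧ Function.Injective h) ∈ homSpan L n := by
  induction hm : Nat.card α using Nat.strong_induction_on generalizing α with
  | _ m ih =>
    classical
    have : Finite (Setoid α) :=
      Finite.of_injective (fun s : Setoid α => fun a b => s a b) fun s t h =>
        Setoid.ext fun a b => iff_of_eq (congrFun (congrFun h a) b)
    have := Fintype.ofFinite (Setoid α)
    have hsum : homCount A v = _ :=
      countMaps_eq_sum_fiber v (fun D h => IsHom A D h) fun _ h => Setoid.ker h
    rw [← Finset.add_sum_erase _ _ (Finset.mem_univ (⊥ : Setoid α))] at hsum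
    have hbot : countMaps v (fun D h => IsHom A D h ∧ Function.Injective h) =
        countMaps v fun D h => IsHom A D h ∧ Setoid.ker h = ⊥ :=
      countMaps_congr v fun D h => by rw [Setoid.injective_iff_ker_bot]
    rw [hbot, ← sub_eq_of_eq_add hsum]
    refine Submodule.sub_mem _ (Submodule.subset_span ⟨α, inferInstance, A, v, hn, rfl⟩)
      (Submodule.sum_mem _ fun s hs => ?_)
    have hlt := card_quotient_lt (Finset.ne_of_mem_erase hs)
    rw [← countMaps_injective_quotient]
    exact ih _ (hm ▸ hlt) _ _ (hlt.le.trans hn) rfl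

theorem countMaps_avoiding_mem_homSpan {L : RelLang} {n : ℕ} {α : Type} [Finite α]
    (v : α) (hn : Nat.card α ≤ n) {N : Set (Σ r : L.Rel, Fin (L.ar r) → α)} (hN : N.Finite)
    (A : Str L α) :
    countMaps v (fun D h => (IsHom A D h ∧ Function.Injective h) ∧
      ∀ t ∈ N, ¬ D.rel t.1 (h ∘ t.2)) ∈ homSpan L n := by
  classical
  induction N, hN using Set.Finite.induction_on generalizing A with
  | empty => simpa using countMaps_injective_mem_homSpan A v hn
  | @insert t N _ _ ih =>
    have hsum := countMaps_eq_sum_fiber v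
      (fun D h => (IsHom A D h ∧ Function.Injective h) ∧ ∀ t ∈ N, ¬ D.rel t.1 (h ∘ t.2))
      fun D h => decide (D.rel t.1 (h ∘ t.2))
    rw [Fintype.sum_bool] at hsum
    have hinsert : countMaps v (fun D h => (IsHom A D h ∧ Function.Injective h) ∧
        ∀ t' ∈ (insert t N : Set (Σ r : L.Rel, Fin (L.ar r) → α)), ¬ D.rel t'.1 (h ∘ t'.2)) = _ :=
      (countMaps_congr v fun D h => by
        rw [Set.forall_mem_insert, decide_eq_false_iff_not]; tauto).trans
        (sub_eq_of_eq_add' hsum).symm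
    rw [hinsert]
    refine Submodule.sub_mem _ (ih A) ?_
    convert ih (A.addTuple t) using 1
    refine countMaps_congr v fun D h => ?_
    rw [isHom_addTuple_iff, decide_eq_true_iff]
    tauto

theorem isEmb_iff_avoiding {L : RelLang} {α δ : Type} (A : Str L α) (D : Str L δ) (h : α → δ) :
    IsEmb A D h ↔ (IsHom A D h ∧ Function.Injective h) ∧
      ∀ t ∈ {t : Σ r : L.Rel, Fin (L.ar r) → α | ¬ A.rel t.1 t.2}, ¬ D.rel t.1 (h ∘ t.2) := by
  constructor
  · rintro ⟨hinj, hrel⟩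
    exact ⟨⟨fun r x => (hrel r x).1, hinj⟩, fun t ht => mt (hrel t.1 t.2).2 ht⟩
  · rintro ⟨⟨hhom, hinj⟩, hN⟩
    exact ⟨hinj, fun r x => ⟨hhom r x, fun hx => by_contra fun hA => hN ⟨r, x⟩ hA hx⟩⟩

theorem countMaps_isEmb_mem_homSpan {L : RelLang} [Finite L.Rel] {α : Type} [Finite α]
    (F : Str L α) (v : α) :
    countMaps v (fun D h => IsEmb F D h) ∈ homSpan L (Nat.card α) := by
  rw [countMaps_congr v (isEmb_iff_avoiding F)]
  exact countMaps_avoiding_mem_homSpan v le_rfl (Set.toFinite _) F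


/-- The number of pointed embeddings of `(F, v)` into any pointed finite structure `(D, u)`
can be written as a fixed rational linear combination of pointed homomorphism counts from
finitely many pointed structures with at most as many elements as `F`. -/
theorem emb_count_eq_rat_linear_combination_of_hom_counts
    {L : RelLang} [Finite L.Rel] {α : Type} [Finite α] (F : Str L α) (v : α) :
    ∃ (k : ℕ) (γ : Fin k → Type) (_ : ∀ i, Finite (γ i))
      (H : ∀ i, Str L (γ i)) (w : ∀ i, γ i) (c : Fin k → ℚ),
      (∀ i, Nat.card (γ i) ≤ Nat.card α) ∧
      ∀ (δ : Type), ∀ _ : Finite δ, ∀ (D : Str L δ) (u : δ),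
        (Nat.card {h : α → δ // IsEmb F D h ∧ h v = u} : ℚ) =
          ∑ i, c i * (Nat.card {h : γ i → δ // IsHom (H i) D h ∧ h (w i) = u} : ℚ) := by
  obtain ⟨k, c, g, hg⟩ := Submodule.mem_span_set'.1 (countMaps_isEmb_mem_homSpan F v)
  choose γ hγ H w hcard hw using fun i => (g i).2
  refine ⟨k, γ, hγ, H, w, c, hcard, fun δ hδ D u => ?_⟩
  have heq := congrFun (congrFun (congrFun hg ⟨δ, hδ⟩) D) u
  simp only [Finset.sum_apply, Pi.smul_apply, smul_eq_mul, hw] at heq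
  exact heq.symm
end

section
/- Let L be a finite relational language and let (F,v) be a pointed finite L-structure with n elements. Then there exist finitely many pointed finite L-structures (G1,w1),…,(Gk,wk), each having at most n elements, and natural numbers c1,…,ck, such that for every pointed finite L-structure (D,u), the number of homomorphisms from (F,v) to (D,u) equals the sum over i of ci times the number of embeddings from (Gi,wi) to (D,u). -/
theorem Str.ext_rel {L : RelLang} {α : Type} {A B : Str L α}
    (h : ∀ r x, A.rel r x ↔ B.rel r x) : A = B := by
  cases A
  cases B
  congr
  funext r x
  exact propext (h r x)

instance Str.finite {L : RelLang} [Finite L.Rel] {α : Type} [Finite α] : Finite (Str L α) :=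
  Finite.of_injective (fun A : Str L α => A.rel) fun _ _ h =>
    Str.ext_rel fun r x => iff_of_eq (congrFun (congrFun h r) x)

theorem IsHom.comp {L : RelLang} {α β γ : Type} {A : Str L α} {B : Str L β} {C : Str L γ}
    {g : β → γ} {f : α → β} (hg : IsHom B C g) (hf : IsHom A B f) : IsHom A C (g ∘ f) :=
  fun r x hx => hg r _ (hf r x hx)

theorem IsEmb.isHom {L : RelLang} {α β : Type} {A : Str L α} {B : Str L β} {f : α → β}
    (hf : IsEmb A B f) : IsHom A B f :=
  fun r x => (hf.2 r x).1

/-- The quotients of the universe of `F` with a structure making the projection a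
homomorphism, i.e. the surjective homomorphic images of `F`. -/
def HomImage {L : RelLang} {α : Type} (F : Str L α) : Type :=
  Σ s : Setoid α, {G : Str L (Quotient s) // IsHom F G (Quotient.mk s)}

instance HomImage.finite {L : RelLang} [Finite L.Rel] {α : Type} [Finite α] (F : Str L α) :
    Finite (HomImage F) :=
  have : Finite (Setoid α) :=
    Finite.of_injective (fun s : Setoid α => s.r) fun _ _ h =>
      Setoid.ext fun a b => iff_of_eq (congrFun (congrFun h a) b)
  inferInstanceAs (Finite (Σ s : Setoid α, {G : Str L (Quotient s) // IsHom F G (Quotient.mk s)}))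

/-- Compose an embedding of a homomorphic image of `F` with the projection. -/
def HomImage.toHom {L : RelLang} {α δ : Type} {F : Str L α} {v : α} {D : Str L δ} {u : δ}
    (p : Σ q : HomImage F, {e : Quotient q.1 → δ // IsEmb q.2.1 D e ∧ e (Quotient.mk q.1 v) = u}) :
    {h : α → δ // IsHom F D h ∧ h v = u} :=
  ⟨p.2.1 ∘ Quotient.mk p.1.1, p.2.2.1.isHom.comp p.1.2.2, p.2.2.2⟩

theorem HomImage.toHom_injective {L : RelLang} {α δ : Type} {F : Str L α} {v : α}
    {D : Str L δ} {u : δ} :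
    Function.Injective (HomImage.toHom (F := F) (v := v) (D := D) (u := u)) := by
  rintro ⟨⟨s, G, hG⟩, e, he, hu⟩ ⟨⟨s', G', hG'⟩, e', he', hu'⟩ h
  have h : e ∘ Quotient.mk s = e' ∘ Quotient.mk s' := congrArg Subtype.val h
  obtain rfl : s = s' := by
    refine Setoid.ext fun a b => ?_
    have ha := congrFun h a
    have hb := congrFun h b
    simp only [Function.comp_apply] at ha hb
    rw [← Quotient.eq (r := s), ← Quotient.eq (r := s'), ← he.1.eq_iff, ← he'.1.eq_iff]
    exact ⟨fun hh => ha.symm.trans (hh.trans hb), fun hh => ha.trans (hh.trans hb.symm)⟩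
  obtain rfl : e = e' := Quotient.mk_surjective.injective_comp_right h
  obtain rfl : G = G' := Str.ext_rel fun r x => (he.2 r x).trans (he'.2 r x).symm
  rfl

theorem HomImage.toHom_surjective {L : RelLang} {α δ : Type} {F : Str L α} {v : α}
    {D : Str L δ} {u : δ} :
    Function.Surjective (HomImage.toHom (F := F) (v := v) (D := D) (u := u)) := by
  rintro ⟨h, hh, hu⟩
  exact ⟨⟨⟨Setoid.ker h, ⟨fun r x => D.rel r (Setoid.kerLift h ∘ x)⟩, fun r x hx => hh r x hx⟩,
    Setoid.kerLift h, ⟨Setoid.kerLift_injective h, fun _ _ => Iff.rfl⟩, hu⟩, rfl⟩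

/-- The number of pointed homomorphisms from `(F, v)` into any pointed finite structure
`(D, u)` can be written as a fixed nonnegative-integer linear combination of pointed
embedding counts from finitely many pointed structures with at most as many elements
as `F`. -/
theorem hom_count_eq_nat_linear_combination_of_emb_counts
    {L : RelLang} [Finite L.Rel] {α : Type} [Finite α] (F : Str L α) (v : α) :
    ∃ (k : ℕ) (γ : Fin k → Type) (_ : ∀ i, Finite (γ i))
      (G : ∀ i, Str L (γ i)) (w : ∀ i, γ i) (c : Fin k → ℕ),
      (∀ i, Nat.card (γ i) ≤ Nat.card α) ∧
      ∀ (δ : Type), ∀ _ : Finite δ, ∀ (D : Str L δ) (u : δ),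
        Nat.card {h : α → δ // IsHom F D h ∧ h v = u} =
          ∑ i, c i * Nat.card {h : γ i → δ // IsEmb (G i) D h ∧ h (w i) = u} := by
  let φ := (Finite.equivFin (HomImage F)).symm
  refine ⟨Nat.card (HomImage F), fun i => Quotient (φ i).1, fun i => inferInstance,
    fun i => (φ i).2.1, fun i => Quotient.mk (φ i).1 v, fun _ => 1,
    fun i => Nat.card_le_card_of_surjective _ Quotient.mk_surjective, fun δ _ D u => ?_⟩
  have := Fintype.ofFinite (HomImage F)
  rw [← Nat.card_eq_of_bijective _ ⟨HomImage.toHom_injective (F := F) (v := v) (D := D) (u := u),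
    HomImage.toHom_surjective⟩, Nat.card_sigma]
  simp only [one_mul]
  exact (Equiv.sum_comp φ fun q : HomImage F =>
    Nat.card {e : Quotient q.1 → δ // IsEmb q.2.1 D e ∧ e (Quotient.mk q.1 v) = u}).symm
end

section
/- Let L be a finite relational language, let (F,v) be a pointed finite L-structure with n elements, and let (D1,u1) and (D2,u2) be pointed finite L-structures. If for every pointed finite L-structure (H,w) with at most n elements the number of homomorphisms from (H,w) to (D1,u1) equals the number of homomorphisms from (H,w) to (D2,u2), then the number of embeddings from (F,v) to (D1,u1) equals the number of embeddings from (F,v) to (D2,u2). -/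
/-- If two finite types have equal cardinality and all fibres of maps from them to `ι` over
`i ≠ i₀` have equal cardinality, then so do the fibres over `i₀`. -/
lemma card_fiber_eq_of_forall_ne {X Y ι : Type} [Finite X] [Finite Y] [Finite ι]
    {p : X → Prop} {q : Y → Prop} (f : X → ι) (g : Y → ι) (i₀ : ι)
    (hpq : Nat.card {x // p x} = Nat.card {y // q y})
    (hne : ∀ i, i ≠ i₀ →
      Nat.card {x // p x ∧ f x = i} = Nat.card {y // q y ∧ g y = i}) :
    Nat.card {x // p x ∧ f x = i₀} = Nat.card {y // q y ∧ g y = i₀} := by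
  classical
  have := Fintype.ofFinite ι
  have card_eq_sum : ∀ {Z : Type} [Finite Z] (p : Z → Prop) (f : Z → ι),
      Nat.card {z // p z} = ∑ i, Nat.card {z // p z ∧ f z = i} := by
    intro Z _ p f
    rw [← Nat.card_congr (Equiv.sigmaFiberEquiv fun z : {z // p z} => f z), Nat.card_sigma]
    exact Finset.sum_congr rfl fun i _ =>
      Nat.card_congr (Equiv.subtypeSubtypeEquivSubtypeInter p fun z => f z = i)
  rw [card_eq_sum p f, card_eq_sum q g, ← Finset.add_sum_erase _ _ (Finset.mem_univ i₀),
    ← Finset.add_sum_erase Finset.univ (fun i => Nat.card {y // q y ∧ g y = i})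
      (Finset.mem_univ i₀),
    Finset.sum_congr rfl fun i hi => hne i (Finset.ne_of_mem_erase hi)] at hpq
  exact Nat.add_right_cancel hpq

namespace Str

variable {L : RelLang} {α β γ : Type}

/-- The image of a structure along a map. -/
def map (f : α → β) (A : Str L α) : Str L β where
  rel r y := ∃ x, A.rel r x ∧ f ∘ x = y

/-- The pullback of a structure along a map. -/
def comap (f : α → β) (B : Str L β) : Str L α where
  rel r x := B.rel r (f ∘ x)

lemma isHom_map_iff (f : α → β) (A : Str L α) (B : Str L γ) (g : β → γ) :
    IsHom (A.map f) B g ↔ IsHom A B (g ∘ f) := by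
  constructor
  · exact fun h r x hx => h r (f ∘ x) ⟨x, hx, rfl⟩
  · rintro h r _ ⟨x, hx, rfl⟩
    exact h r x hx

end Str

/-- Homomorphisms with kernel `s` correspond to injective homomorphisms on the quotient by `s`. -/
lemma card_hom_ker_eq {L : RelLang} {γ β : Type} (H : Str L γ) (w : γ) (D : Str L β) (u : β)
    (s : Setoid γ) :
    Nat.card {h : γ → β // (IsHom H D h ∧ h w = u) ∧ Setoid.ker h = s} =
      Nat.card {h : Quotient s → β //
        (IsHom (H.map (Quotient.mk s)) D h ∧ h (Quotient.mk s w) = u) ∧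
          Function.Injective h} := by
  symm
  refine Nat.card_congr (Equiv.ofBijective
    (fun g => ⟨g.1 ∘ Quotient.mk s,
      ⟨(Str.isHom_map_iff _ _ _ _).1 g.2.1.1, g.2.1.2⟩, ?_⟩) ⟨?_, ?_⟩)
  · ext a b
    rw [Setoid.ker_def]
    exact g.2.2.eq_iff.trans Quotient.eq
  · intro g g' h
    exact Subtype.ext (Quotient.mk_surjective.injective_comp_right (congrArg Subtype.val h))
  · rintro ⟨h, ⟨hh, hw⟩, rfl⟩
    exact ⟨⟨Setoid.kerLift h, ⟨(Str.isHom_map_iff _ _ _ _).2 hh, hw⟩,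
      Setoid.kerLift_injective h⟩, rfl⟩

lemma card_quotient_lt_of_ne_bot {γ : Type} [Finite γ] {s : Setoid γ} (hs : s ≠ ⊥) :
    Nat.card (Quotient s) < Nat.card γ := by
  refine lt_of_le_of_ne (Nat.card_le_card_of_surjective _ Quotient.mk_surjective) fun h => hs ?_
  have hbij := (Nat.bijective_iff_surjective_and_card (Quotient.mk s)).2
    ⟨Quotient.mk_surjective, h.symm⟩
  rw [← Setoid.ker_mk_eq s]
  exact (Setoid.injective_iff_ker_bot _).1 hbij.1

/-- Equality of pointed homomorphism counts from all structures of size at most `n` implies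
equality of pointed injective homomorphism counts. -/
lemma card_injective_hom_eq_of_card_hom_eq {L : RelLang} {β₁ β₂ : Type} [Finite β₁] [Finite β₂]
    (D₁ : Str L β₁) (u₁ : β₁) (D₂ : Str L β₂) (u₂ : β₂) (n : ℕ)
    (hyp : ∀ (γ : Type), ∀ _ : Finite γ, ∀ (H : Str L γ) (w : γ), Nat.card γ ≤ n →
      Nat.card {h : γ → β₁ // IsHom H D₁ h ∧ h w = u₁} =
        Nat.card {h : γ → β₂ // IsHom H D₂ h ∧ h w = u₂})
    (γ : Type) [Finite γ] (H : Str L γ) (w : γ) (hn : Nat.card γ ≤ n) :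
    Nat.card {h : γ → β₁ // (IsHom H D₁ h ∧ h w = u₁) ∧ Function.Injective h} =
      Nat.card {h : γ → β₂ // (IsHom H D₂ h ∧ h w = u₂) ∧ Function.Injective h} := by
  induction hm : Nat.card γ using Nat.strong_induction_on generalizing γ with
  | _ m ih =>
    subst hm
    simp only [Setoid.injective_iff_ker_bot]
    have : Finite (Setoid γ) :=
      Finite.of_injective (fun s : Setoid γ => s.r) fun s t h => Setoid.ext fun a b => by
        exact iff_of_eq (congrFun (congrFun h a) b)
    refine card_fiber_eq_of_forall_ne Setoid.ker Setoid.ker ⊥ (hyp γ ‹_› H w hn) fun s hs => ?_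
    have hlt := card_quotient_lt_of_ne_bot hs
    rw [card_hom_ker_eq, card_hom_ker_eq]
    exact ih _ hlt _ _ _ (hlt.le.trans hn) rfl

/-- Equality of pointed injective homomorphism counts from all structures on a fixed universe
implies equality of pointed embedding counts. -/
lemma card_emb_eq_of_card_injective_hom_eq {L : RelLang} [Finite L.Rel] {α β₁ β₂ : Type}
    [Finite α] [Finite β₁] [Finite β₂] (v : α)
    (D₁ : Str L β₁) (u₁ : β₁) (D₂ : Str L β₂) (u₂ : β₂)
    (hyp : ∀ H : Str L α,
      Nat.card {h : α → β₁ // (IsHom H D₁ h ∧ h v = u₁) ∧ Function.Injective h} =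
        Nat.card {h : α → β₂ // (IsHom H D₂ h ∧ h v = u₂) ∧ Function.Injective h})
    (R : ∀ r : L.Rel, (Fin (L.ar r) → α) → Prop) :
    Nat.card {h : α → β₁ // IsEmb ⟨R⟩ D₁ h ∧ h v = u₁} =
      Nat.card {h : α → β₂ // IsEmb ⟨R⟩ D₂ h ∧ h v = u₂} := by
  have fiber : ∀ {β : Type} (D : Str L β) (u : β) (R S : ∀ r : L.Rel, (Fin (L.ar r) → α) → Prop),
      R ≤ S → ∀ h : α → β, ((IsHom ⟨R⟩ D h ∧ h v = u) ∧ Function.Injective h) ∧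
        (D.comap h).rel = S ↔ IsEmb ⟨S⟩ D h ∧ h v = u := by
    intro β D u R S hRS h
    constructor
    · rintro ⟨⟨⟨-, hv⟩, hinj⟩, rfl⟩
      exact ⟨⟨hinj, fun r x => Iff.rfl⟩, hv⟩
    · rintro ⟨⟨hinj, hS⟩, hv⟩
      refine ⟨⟨⟨fun r x hx => (hS r x).1 (hRS r x hx), hv⟩, hinj⟩, ?_⟩
      funext r x
      exact propext (hS r x).symm
  induction R using WellFoundedGT.induction with
  | _ R ih =>
    have key := card_fiber_eq_of_forall_ne (fun h => (D₁.comap h).rel)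
      (fun h => (D₂.comap h).rel) R (hyp ⟨R⟩) fun S hS => ?_
    · simpa only [fiber _ _ R R le_rfl] using key
    · by_cases hRS : R ≤ S
      · simpa only [fiber _ _ R S hRS] using ih S (lt_of_le_of_ne hRS hS.symm)
      · have empty : ∀ {β : Type} (D : Str L β) (u : β), IsEmpty {h : α → β //
            ((IsHom ⟨R⟩ D h ∧ h v = u) ∧ Function.Injective h) ∧ (D.comap h).rel = S} := by
          refine fun D u => ⟨fun ⟨h, ⟨⟨hh, _⟩, _⟩, hS⟩ => hRS ?_⟩
          rw [← hS]
          exact hh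
        have := empty D₁ u₁
        have := empty D₂ u₂
        simp only [Nat.card_of_isEmpty]

/-- If two pointed finite structures are indistinguishable by pointed homomorphism counts
from all pointed structures with at most `|F|` elements, then they admit the same number
of pointed embeddings of `(F, v)`. -/
theorem emb_count_eq_of_hom_counts_eq
    {L : RelLang} [Finite L.Rel] {α β₁ β₂ : Type} [Finite α] [Finite β₁] [Finite β₂]
    (F : Str L α) (v : α) (D₁ : Str L β₁) (u₁ : β₁) (D₂ : Str L β₂) (u₂ : β₂)
    (hyp : ∀ (γ : Type), ∀ _ : Finite γ, ∀ (H : Str L γ) (w : γ),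
      Nat.card γ ≤ Nat.card α →
      Nat.card {h : γ → β₁ // IsHom H D₁ h ∧ h w = u₁} =
        Nat.card {h : γ → β₂ // IsHom H D₂ h ∧ h w = u₂}) :
    Nat.card {h : α → β₁ // IsEmb F D₁ h ∧ h v = u₁} =
      Nat.card {h : α → β₂ // IsEmb F D₂ h ∧ h v = u₂} := by
  exact card_emb_eq_of_card_injective_hom_eq v D₁ u₁ D₂ u₂
    (fun H => card_injective_hom_eq_of_card_hom_eq D₁ u₁ D₂ u₂ _ hyp α H v le_rfl) F.rel
end

section
/- Let L be a finite relational language, let (F,v) be a pointed finite L-structure with n elements, and let (D1,u1) and (D2,u2) be pointed finite L-structures. If for every pointed finite L-structure (H,w) with at most n elements the number of embeddings from (H,w) to (D1,u1) equals the number of embeddings from (H,w) to (D2,u2), then the number of homomorphisms from (F,v) to (D1,u1) equals the number of homomorphisms from (F,v) to (D2,u2). -/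
/-- A pointed homomorphism out of `F` is the same as a structure on a quotient of `F` for which
the quotient map is a homomorphism, together with a pointed embedding of that quotient. -/
noncomputable def homEquivSigmaEmb {L : RelLang} {α β : Type} (F : Str L α) (v : α)
    (D : Str L β) (u : β) :
    (Σ p : {p : Σ s : Setoid α, Str L (Quotient s) // IsHom F p.2 (Quotient.mk p.1)},
      {e : Quotient p.1.1 → β // IsEmb p.1.2 D e ∧ e (Quotient.mk p.1.1 v) = u}) ≃
    {h : α → β // IsHom F D h ∧ h v = u} :=
  Equiv.ofBijective
    (fun q => ⟨q.2.1 ∘ Quotient.mk q.1.1.1,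
      fun r x hx => (q.2.2.1.2 r _).1 (q.1.2 r x hx), q.2.2.2⟩) <| by
    constructor
    · rintro ⟨⟨⟨s, H⟩, hp⟩, e, he, hv⟩ ⟨⟨⟨s', H'⟩, hp'⟩, e', he', hv'⟩ hq
      have hfun : ∀ a, e (Quotient.mk s a) = e' (Quotient.mk s' a) :=
        fun a => congrFun (congrArg Subtype.val hq) a
      obtain rfl : s = s' := by
        ext a b
        rw [← Quotient.eq (r := s), ← Quotient.eq (r := s'), ← he.1.eq_iff, ← he'.1.eq_iff]
        exact iff_of_eq (congrArg₂ Eq (hfun a) (hfun b))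
      obtain rfl : e = e' := funext fun a => Quotient.inductionOn a hfun
      obtain rfl : H = H' := by
        rcases H with ⟨R⟩
        rcases H' with ⟨R'⟩
        congr 1
        funext r x
        exact propext ((he.2 r x).trans (he'.2 r x).symm)
      rfl
    · rintro ⟨h, hh, hv⟩
      refine ⟨⟨⟨⟨Setoid.ker h, ⟨fun r x => D.rel r (Setoid.kerLift h ∘ x)⟩⟩,
        fun r x hx => hh r x hx⟩, Setoid.kerLift h,
        ⟨Setoid.kerLift_injective h, fun _ _ => Iff.rfl⟩, hv⟩, rfl⟩

/-- If two pointed finite structures are indistinguishable by pointed embedding counts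
from all pointed structures with at most `|F|` elements, then they admit the same number
of pointed homomorphisms from `(F, v)`. -/
theorem hom_count_eq_of_emb_counts_eq
    {L : RelLang} [Finite L.Rel] {α β₁ β₂ : Type} [Finite α] [Finite β₁] [Finite β₂]
    (F : Str L α) (v : α) (D₁ : Str L β₁) (u₁ : β₁) (D₂ : Str L β₂) (u₂ : β₂)
    (hyp : ∀ (γ : Type), ∀ _ : Finite γ, ∀ (H : Str L γ) (w : γ),
      Nat.card γ ≤ Nat.card α →
      Nat.card {h : γ → β₁ // IsEmb H D₁ h ∧ h w = u₁} =
        Nat.card {h : γ → β₂ // IsEmb H D₂ h ∧ h w = u₂}) :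
    Nat.card {h : α → β₁ // IsHom F D₁ h ∧ h v = u₁} =
      Nat.card {h : α → β₂ // IsHom F D₂ h ∧ h v = u₂} := by
  have key (p : {p : Σ s : Setoid α, Str L (Quotient s) // IsHom F p.2 (Quotient.mk p.1)}) :
      Nonempty ({e : Quotient p.1.1 → β₁ // IsEmb p.1.2 D₁ e ∧ e (Quotient.mk p.1.1 v) = u₁} ≃
        {e : Quotient p.1.1 → β₂ // IsEmb p.1.2 D₂ e ∧ e (Quotient.mk p.1.1 v) = u₂}) :=
    Finite.card_eq.1 (hyp _ inferInstance _ _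
      (Nat.card_le_card_of_surjective _ Quotient.mk_surjective))
  exact Nat.card_congr ((homEquivSigmaEmb F v D₁ u₁).symm.trans
    ((Equiv.sigmaCongrRight fun p => (key p).some).trans (homEquivSigmaEmb F v D₂ u₂)))
end

section
/- Let L be a finite relational language and let (F,v) be a pointed finite L-structure. Then there exist integers μ_P, one for each partition P of the universe of F and depending only on (F,v), such that for every pointed finite L-structure (D,u) and every function Φ assigning to each element x of F a subset Φ(x) of the universe of D, the number of injective homomorphisms h from (F,v) to (D,u) satisfying h(x)∈Φ(x) for every x equals the sum over all partitions P of μ_P times the number of homomorphisms g from the pointed quotient (F/P,[v]) to (D,u) satisfying, for every x, that g([x]) lies in the intersection of Φ(y) over all y in the class [x]. -/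
/-- The quotient structure of `A` under a partition (equivalence relation) `P`:
a relation holds on classes iff it holds on some representatives. -/
def quotStr {L : RelLang} {α : Type} (A : Str L α) (P : Setoid α) : Str L (Quotient P) where
  rel r x := ∃ y : Fin (L.ar r) → α, (∀ i, Quotient.mk P (y i) = x i) ∧ A.rel r y

instance setoidFinite (α : Type) [Finite α] : Finite (Setoid α) :=
  Finite.of_injective (fun s : Setoid α => s.r)
    (fun a b h => by cases a; cases b; cases h; rfl)

noncomputable instance setoidFintype (α : Type) [Finite α] : Fintype (Setoid α) :=
  Fintype.ofFinite _

/-- Homomorphisms out of a quotient structure are the homomorphisms constant on its classes. -/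
theorem isHom_quotStr_iff {L : RelLang} {α β : Type} (A : Str L α) (P : Setoid α)
    (B : Str L β) (g : Quotient P → β) :
    IsHom (quotStr A P) B g ↔ IsHom A B (fun x => g (Quotient.mk P x)) := by
  constructor
  · intro hg r x hx
    exact hg r (fun i => Quotient.mk P (x i)) ⟨x, fun _ => rfl, hx⟩
  · rintro hg r x ⟨y, hy, hA⟩
    obtain rfl : (fun i => Quotient.mk P (y i)) = x := funext hy
    exact hg r y hA

theorem forall_mem_iInter_class_iff {α β : Type} (P : Setoid α) (g : Quotient P → β)
    (Φ : α → Set β) :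
    (∀ x : α, g (Quotient.mk P x) ∈ ⋂ y ∈ {y : α | P.r y x}, Φ y) ↔
      ∀ x : α, g (Quotient.mk P x) ∈ Φ x := by
  simp only [Set.mem_iInter, Set.mem_ofPred_eq]
  constructor
  · intro h x
    exact h x x (P.refl x)
  · intro h x y hyx
    have hq : Quotient.mk P y = Quotient.mk P x := Quotient.sound hyx
    exact hq ▸ h y

/-- Constrained pointed homomorphisms out of `F/P` are the constrained pointed homomorphisms
out of `F` whose kernel is coarser than `P`. -/
def quotHomEquiv {L : RelLang} {α β : Type} (F : Str L α) (v : α) (P : Setoid α)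
    (D : Str L β) (u : β) (Φ : α → Set β) :
    {g : Quotient P → β // IsHom (quotStr F P) D g ∧ g (Quotient.mk P v) = u ∧
      ∀ x : α, g (Quotient.mk P x) ∈ ⋂ y ∈ {y : α | P.r y x}, Φ y} ≃
    {h : α → β // (IsHom F D h ∧ h v = u ∧ ∀ x : α, h x ∈ Φ x) ∧ P ≤ Setoid.ker h} where
  toFun g := ⟨fun x => g.1 (Quotient.mk P x),
    ⟨(isHom_quotStr_iff F P D g.1).1 g.2.1, g.2.2.1,
      (forall_mem_iInter_class_iff P g.1 Φ).1 g.2.2.2⟩,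
    fun _ _ hxy => congrArg g.1 (Quotient.sound hxy)⟩
  invFun h := ⟨Quotient.lift h.1 (fun _ _ hxy => h.2.2 hxy),
    (isHom_quotStr_iff F P D _).2 h.2.1.1, h.2.1.2.1,
    (forall_mem_iInter_class_iff P _ Φ).2 h.2.1.2.2⟩
  left_inv _ := Subtype.ext (funext fun q => Quotient.inductionOn q fun _ => rfl)
  right_inv _ := rfl

open Classical in
/-- A finite order with a least element carries a Möbius function based at that element. -/
theorem exists_sum_le_eq_ite_eq_bot (ι : Type*) [PartialOrder ι] [OrderBot ι] [Fintype ι] :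
    ∃ μ : ι → ℤ, ∀ k : ι, (∑ p : ι, if p ≤ k then μ p else 0) =
      if k = ⊥ then 1 else 0 := by
  classical
  let _ : LocallyFiniteOrder ι := Fintype.toLocallyFiniteOrder
  refine ⟨fun p => IncidenceAlgebra.mu ℤ (⊥ : ι) p, fun k => ?_⟩
  have h := IncidenceAlgebra.sum_Icc_mu_right (𝕜 := ℤ) (⊥ : ι) k
  rw [← Finset.sum_filter]
  have hs : Finset.univ.filter (fun p : ι => p ≤ k) = Finset.Icc ⊥ k := by
    ext p
    simp
  rw [hs, h]
  simp only [eq_comm]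

/-- There are integer coefficients `μ P`, one for each partition `P` of the universe of `F`
and depending only on the pointed structure `(F, v)`, such that for every pointed finite
structure `(D, u)` and every constraint function `Φ`, the number of injective pointed
homomorphisms `h` from `(F, v)` to `(D, u)` with `h x ∈ Φ x` for all `x` equals the sum
over all partitions `P` of `μ P` times the number of pointed homomorphisms `g` from the
pointed quotient `(F/P, [v])` to `(D, u)` with `g [x] ∈ ⋂ y ∈ [x], Φ y` for all `x`. -/
theorem injHom_count_with_constraints_eq_int_combination_of_quotient_hom_counts
    {L : RelLang} [Finite L.Rel] {α : Type} [Finite α] (F : Str L α) (v : α) :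
    ∃ μ : Setoid α → ℤ,
      ∀ (β : Type), ∀ _ : Finite β, ∀ (D : Str L β) (u : β) (Φ : α → Set β),
        (Nat.card {h : α → β // IsHom F D h ∧ Function.Injective h ∧ h v = u ∧
            ∀ x : α, h x ∈ Φ x} : ℤ) =
          ∑ P : Setoid α, μ P *
            (Nat.card {g : Quotient P → β // IsHom (quotStr F P) D g ∧
              g (Quotient.mk P v) = u ∧
              ∀ x : α, g (Quotient.mk P x) ∈ ⋂ y ∈ {y : α | P.r y x}, Φ y} : ℤ) := by
  classical
  obtain ⟨μ, hμ⟩ := exists_sum_le_eq_ite_eq_bot (Setoid α)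
  refine ⟨μ, fun β _ D u Φ => ?_⟩
  have : Fintype α := Fintype.ofFinite α
  have : Fintype β := Fintype.ofFinite β
  set S : Finset (α → β) :=
    Finset.univ.filter fun h => IsHom F D h ∧ h v = u ∧ ∀ x, h x ∈ Φ x with hS
  have hinj : Nat.card {h : α → β // IsHom F D h ∧ Function.Injective h ∧ h v = u ∧
      ∀ x : α, h x ∈ Φ x} = (S.filter fun h => Setoid.ker h = ⊥).card := by
    rw [Nat.card_eq_fintype_card, Fintype.card_subtype, hS, Finset.filter_filter]
    congr 1
    ext h
    simp only [Finset.mem_filter, Finset.mem_univ, true_and, ← Setoid.injective_iff_ker_bot]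
    tauto
  have hquot (P : Setoid α) : Nat.card {g : Quotient P → β // IsHom (quotStr F P) D g ∧
      g (Quotient.mk P v) = u ∧
      ∀ x : α, g (Quotient.mk P x) ∈ ⋂ y ∈ {y : α | P.r y x}, Φ y} =
      (S.filter fun h => P ≤ Setoid.ker h).card := by
    rw [Nat.card_congr (quotHomEquiv F v P D u Φ), Nat.card_eq_fintype_card,
      Fintype.card_subtype, hS, Finset.filter_filter]
  simp only [hinj, hquot, Finset.card_filter, Nat.cast_sum, Nat.cast_ite, Nat.cast_one,
    Nat.cast_zero, Finset.mul_sum, mul_ite, mul_one, mul_zero]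
  rw [Finset.sum_comm]
  exact Finset.sum_congr rfl fun h _ => (hμ (Setoid.ker h)).symm
end

section
/- Let (F,w), (G1,u1) and (G2,u2) be pointed finite simple graphs, and let n be the number of vertices of F. If for every pointed finite simple graph (K,w') with at most n vertices the number of pointed homomorphisms from (K,w') to (G1,u1) equals the number of pointed homomorphisms from (K,w') to (G2,u2), then the number of pointed embeddings of (F,w) into (G1,u1) equals the number of pointed embeddings of (F,w) into (G2,u2). -/
/-- Two finite types with equally many elements, both mapped to a finite type `ι`, have equally
large fibers over `i` as soon as this holds over every other point. -/
theorem card_fiber_eq_of_card_eq {ι A B : Type*} [Finite ι] [Finite A] [Finite B]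
    (a : A → ι) (b : B → ι) (i : ι) (h : Nat.card A = Nat.card B)
    (hne : ∀ j, j ≠ i → Nat.card {x // a x = j} = Nat.card {x // b x = j}) :
    Nat.card {x // a x = i} = Nat.card {x // b x = i} := by
  classical
  have := Fintype.ofFinite ι
  rw [← Nat.card_congr (Equiv.sigmaFiberEquiv a), ← Nat.card_congr (Equiv.sigmaFiberEquiv b),
    Nat.card_sigma, Nat.card_sigma, ← Finset.add_sum_erase _ _ (Finset.mem_univ i),
    ← Finset.add_sum_erase _ _ (Finset.mem_univ i),
    Finset.sum_congr rfl fun j hj => hne j (Finset.ne_of_mem_erase hj)] at h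
  exact Nat.add_right_cancel h

namespace SimpleGraph

variable {γ β : Type*}

/-- The quotient of a simple graph by a setoid, with loops removed. -/
def quotientBy (K : SimpleGraph γ) (s : Setoid γ) : SimpleGraph (Quotient s) :=
  fromRel fun a b => ∃ x y, K.Adj x y ∧ Quotient.mk s x = a ∧ Quotient.mk s y = b

/-- Pointed homomorphisms with kernel `s`, where no edge lies in a class of `s`, are the
injective pointed homomorphisms from the quotient by `s`. -/
def homWithKerEquiv (K : SimpleGraph γ) (w : γ) (G : SimpleGraph β) (u : β) (s : Setoid γ)
    (hs : ∀ x y, K.Adj x y → ¬ s x y) :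
    {f : {f : K →g G // f w = u} // Setoid.ker f.1 = s} ≃
      {f : K.quotientBy s →g G // f (Quotient.mk s w) = u ∧ Function.Injective f} where
  toFun f := ⟨⟨Quotient.lift f.1.1 fun x y (h : s x y) => by rw [← f.2] at h; exact h, by
      rintro a b ⟨-, ⟨x, y, h, rfl, rfl⟩ | ⟨x, y, h, rfl, rfl⟩⟩
      · exact f.1.1.map_adj h
      · exact (f.1.1.map_adj h).symm⟩, f.1.2, by
      rintro ⟨x⟩ ⟨y⟩ h
      refine Quotient.sound (?_ : s x y)
      rw [← f.2]
      exact h⟩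
  invFun g := ⟨⟨⟨fun x => g.1 (Quotient.mk s x), fun {x y} h => g.1.map_adj
      ⟨fun e => hs x y h (Quotient.exact e), Or.inl ⟨x, y, h, rfl, rfl⟩⟩⟩, g.2.1⟩, by
      ext x y
      exact ⟨fun h => Quotient.exact (g.2.2 h), fun h => congrArg g.1 (Quotient.sound h)⟩⟩
  left_inv f := rfl
  right_inv g := by
    ext ⟨x⟩
    rfl

/-- Pointed homomorphisms with kernel `⊥` are the injective ones. -/
def homWithKerBotEquiv (K : SimpleGraph γ) (w : γ) (G : SimpleGraph β) (u : β) :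
    {f : {f : K →g G // f w = u} // Setoid.ker f.1 = ⊥} ≃
      {f : K →g G // f w = u ∧ Function.Injective f} :=
  (Equiv.subtypeEquivRight fun f : {f : K →g G // f w = u} =>
    (Setoid.injective_iff_ker_bot f.1).symm).trans
    (Equiv.subtypeSubtypeEquivSubtypeInter (fun f : K →g G => f w = u)
      fun f => Function.Injective f)

/-- Injective pointed homomorphisms from `K` that pull `G` back to `K'` are the pointed
embeddings of `K'`, when `K ≤ K'`. -/
def injHomWithComapEquiv (K : SimpleGraph γ) (w : γ) (G : SimpleGraph β) (u : β)
    (K' : SimpleGraph γ) (hK : K ≤ K') :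
    {f : {f : K →g G // f w = u ∧ Function.Injective f} // G.comap f.1 = K'} ≃
      {f : K' ↪g G // f w = u} where
  toFun f := ⟨⟨⟨f.1.1, f.1.2.2⟩, fun {x y} =>
    iff_of_eq (congrArg (fun H : SimpleGraph γ => H.Adj x y) f.2)⟩, f.1.2.1⟩
  invFun g := ⟨⟨⟨g.1, fun h => g.1.map_adj_iff.2 (hK h)⟩, g.2, g.1.injective⟩, by
    ext x y
    exact g.1.map_adj_iff⟩
  left_inv f := rfl
  right_inv g := rfl

theorem card_pointed_inj_hom_eq {β₁ β₂ : Type} [Finite β₁] [Finite β₂]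
    (G₁ : SimpleGraph β₁) (u₁ : β₁) (G₂ : SimpleGraph β₂) (u₂ : β₂) (n : ℕ)
    (hyp : ∀ (γ : Type), ∀ _ : Finite γ, ∀ (K : SimpleGraph γ) (w : γ), Nat.card γ ≤ n →
      Nat.card {f : K →g G₁ // f w = u₁} = Nat.card {f : K →g G₂ // f w = u₂})
    (γ : Type) [Finite γ] (K : SimpleGraph γ) (w : γ) (hn : Nat.card γ ≤ n) :
    Nat.card {f : K →g G₁ // f w = u₁ ∧ Function.Injective f} =
      Nat.card {f : K →g G₂ // f w = u₂ ∧ Function.Injective f} := by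
  induction hm : Nat.card γ using Nat.strong_induction_on generalizing γ with
  | _ m ih =>
  have : Finite (K →g G₁) := DFunLike.finite _
  have : Finite (K →g G₂) := DFunLike.finite _
  have : Finite (Setoid γ) := Finite.of_injective (fun s : Setoid γ => s.r) fun s t h =>
    Setoid.ext fun x y => iff_of_eq (congrFun (congrFun h x) y)
  rw [← Nat.card_congr (homWithKerBotEquiv K w G₁ u₁),
    ← Nat.card_congr (homWithKerBotEquiv K w G₂ u₂)]
  refine card_fiber_eq_of_card_eq (fun f : {f : K →g G₁ // f w = u₁} => Setoid.ker f.1)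
    (fun f : {f : K →g G₂ // f w = u₂} => Setoid.ker f.1) ⊥ (hyp γ ‹_› K w hn) fun s hs => ?_
  by_cases hK : ∀ x y, K.Adj x y → ¬ s x y
  · rw [Nat.card_congr (homWithKerEquiv K w G₁ u₁ s hK),
      Nat.card_congr (homWithKerEquiv K w G₂ u₂ s hK)]
    have hlt : Nat.card (Quotient s) < Nat.card γ := by
      refine (Nat.card_le_card_of_surjective _ (Quotient.mk_surjective (s := s))).lt_of_ne
        fun h => hs ?_
      have hinj := ((Nat.bijective_iff_surjective_and_card _).2
        ⟨Quotient.mk_surjective (s := s), h.symm⟩).injective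
      exact eq_bot_iff.2 fun x y hxy => hinj (Quotient.sound hxy)
    exact ih _ (hm ▸ hlt) _ _ _ (hlt.le.trans hn) rfl
  · push Not at hK
    obtain ⟨x, y, hxy, hs⟩ := hK
    have key {β : Type} (G : SimpleGraph β) (u : β) :
        IsEmpty {f : {f : K →g G // f w = u} // Setoid.ker f.1 = s} := by
      refine ⟨fun f => (f.1.1.map_adj hxy).ne ?_⟩
      rw [← f.2] at hs
      exact hs
    have := key G₁ u₁
    have := key G₂ u₂
    simp only [Nat.card_of_isEmpty]

theorem card_pointed_embedding_eq {α β₁ β₂ : Type} [Finite α] [Finite β₁] [Finite β₂]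
    (w : α) (G₁ : SimpleGraph β₁) (u₁ : β₁) (G₂ : SimpleGraph β₂) (u₂ : β₂)
    (h : ∀ K : SimpleGraph α,
      Nat.card {f : K →g G₁ // f w = u₁ ∧ Function.Injective f} =
        Nat.card {f : K →g G₂ // f w = u₂ ∧ Function.Injective f}) (F : SimpleGraph α) :
    Nat.card {f : F ↪g G₁ // f w = u₁} = Nat.card {f : F ↪g G₂ // f w = u₂} := by
  induction F using WellFoundedGT.induction with
  | _ F ih =>
  have : Finite (F →g G₁) := DFunLike.finite _
  have : Finite (F →g G₂) := DFunLike.finite _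
  rw [← Nat.card_congr (injHomWithComapEquiv F w G₁ u₁ F le_rfl),
    ← Nat.card_congr (injHomWithComapEquiv F w G₂ u₂ F le_rfl)]
  refine card_fiber_eq_of_card_eq
    (fun f : {f : F →g G₁ // f w = u₁ ∧ Function.Injective f} => G₁.comap f.1)
    (fun f : {f : F →g G₂ // f w = u₂ ∧ Function.Injective f} => G₂.comap f.1)
    F (h F) fun K hK => ?_
  by_cases hFK : F ≤ K
  · rw [Nat.card_congr (injHomWithComapEquiv F w G₁ u₁ K hFK),
      Nat.card_congr (injHomWithComapEquiv F w G₂ u₂ K hFK)]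
    exact ih K (hFK.lt_of_ne hK.symm)
  · have key {β : Type} (G : SimpleGraph β) (u : β) :
        IsEmpty {f : {f : F →g G // f w = u ∧ Function.Injective f} // G.comap f.1 = K} :=
      ⟨fun f => hFK (f.2 ▸ fun _ _ hxy => f.1.1.map_adj hxy)⟩
    have := key G₁ u₁
    have := key G₂ u₂
    simp only [Nat.card_of_isEmpty]

end SimpleGraph


/-- If two pointed finite simple graphs `(G₁, u₁)` and `(G₂, u₂)` admit the same number of
pointed homomorphisms from every pointed finite simple graph with at most `|F|` vertices,
then they admit the same number of pointed embeddings of `(F, w)`. -/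
theorem pointed_emb_count_eq_of_pointed_hom_counts_eq
    {α β₁ β₂ : Type} [Finite α] [Finite β₁] [Finite β₂]
    (F : SimpleGraph α) (w : α)
    (G₁ : SimpleGraph β₁) (u₁ : β₁) (G₂ : SimpleGraph β₂) (u₂ : β₂)
    (hyp : ∀ (γ : Type), ∀ _ : Finite γ, ∀ (K : SimpleGraph γ) (w' : γ),
      Nat.card γ ≤ Nat.card α →
      Nat.card {f : K →g G₁ // f w' = u₁} = Nat.card {f : K →g G₂ // f w' = u₂}) :
    Nat.card {f : F ↪g G₁ // f w = u₁} = Nat.card {f : F ↪g G₂ // f w = u₂} := by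
  exact SimpleGraph.card_pointed_embedding_eq w G₁ u₁ G₂ u₂ (fun K =>
    SimpleGraph.card_pointed_inj_hom_eq G₁ u₁ G₂ u₂ _ hyp α K w le_rfl) F
end
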